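/- In the attacked channel-free TCP system G_a (Peer A and Peer B with timeout, composed with the attacked network), the string listen_A · SYN_BN · SYN_NA · SYN_ACK_AN · ACK_NA · FIN_AN · ACK_NA belongs to L(G_a); the global state reached after it has Peer A at 'FIN wait 2', Peer B at 'SYN sent', and the network at its initial state, and this state is a deadlock: no event σ satisfies that the string followed by σ is in L(G_a). In particular, the attacked system can reach a deadlock in which neither peer is at 'closed', violating the liveness property of Threat Model 3. -/

import Mathlib

/-! Channel-free model of TCP connection establishment (three-way handshake):
Peer A and Peer B (with timeout), composed synchronously with a network automaton. -/

/-- Packet types. -/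
inductive Pkt | syn | ack | fin | synack deriving DecidableEq

/-- Events of the channel-free TCP system: `an m` = packet `m` sent from Peer A to the
network, `na m` = from the network to Peer A, `bn m` = from Peer B to the network,
`nb m` = from the network to Peer B, plus the private peer events. -/
inductive Ev
  | an : Pkt → Ev
  | na : Pkt → Ev
  | bn : Pkt → Ev
  | nb : Pkt → Ev
  | listenA | listenB | timeoutA | timeoutB | delA | delB
  deriving DecidableEq

/-- TCP peer states. -/
inductive PSt
  | closed | synsent | listen | i0 | i1 | i2 | established | synreceived | i3
  | closewait | lastack | finwait1 | finwait2 | i4 | i5 | closing | timewait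
  deriving DecidableEq

/-- TCP peer transitions (with timeout), parametrized by the peer's send events `snd`,
receive events `rcv`, and private events `lst`, `tmo`, `del`. -/
def peerTrans (snd rcv : Pkt → Ev) (lst tmo del : Ev) : List (PSt × Ev × PSt) :=
  [(.closed, snd .syn, .synsent), (.synsent, rcv .synack, .i0), (.i0, snd .ack, .established),
   (.synsent, rcv .syn, .i1), (.i1, snd .ack, .synreceived),
   (.synreceived, rcv .ack, .established),
   (.closed, lst, .listen), (.listen, tmo, .closed), (.listen, rcv .syn, .i2),
   (.i2, snd .synack, .synreceived),
   (.established, rcv .fin, .i3), (.i3, snd .ack, .closewait),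
   (.closewait, snd .fin, .lastack), (.lastack, rcv .ack, .closed),
   (.established, snd .fin, .finwait1), (.finwait1, rcv .ack, .finwait2),
   (.finwait1, rcv .fin, .i4), (.finwait2, rcv .fin, .i5),
   (.i4, snd .ack, .closing), (.closing, rcv .ack, .closed),
   (.i5, snd .ack, .timewait), (.timewait, del, .closed)]

/-- A peer's alphabet. -/
def peerAlph (snd rcv : Pkt → Ev) (lst tmo del : Ev) (e : Ev) : Prop :=
  (∃ m, e = snd m) ∨ (∃ m, e = rcv m) ∨ e = lst ∨ e = tmo ∨ e = del

/-- Peer A: sends `an m`, receives `na m`. -/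
def peerAStep (q : PSt) (e : Ev) (q' : PSt) : Prop :=
  (q, e, q') ∈ peerTrans Ev.an Ev.na .listenA .timeoutA .delA
def peerAAlph : Ev → Prop := peerAlph Ev.an Ev.na .listenA .timeoutA .delA

/-- Peer B: sends `bn m`, receives `nb m`. -/
def peerBStep (q : PSt) (e : Ev) (q' : PSt) : Prop :=
  (q, e, q') ∈ peerTrans Ev.bn Ev.nb .listenB .timeoutB .delB
def peerBAlph : Ev → Prop := peerAlph Ev.bn Ev.nb .listenB .timeoutB .delB

/-- Network states: `init`, plus a state `qa m` / `qb m` per packet in transit. -/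
inductive NSt | init | qa : Pkt → NSt | qb : Pkt → NSt
  deriving DecidableEq

/-- The network alphabet: all packet events. -/
def netAlph (e : Ev) : Prop :=
  (∃ m, e = Ev.an m) ∨ (∃ m, e = Ev.na m) ∨ (∃ m, e = Ev.bn m) ∨ (∃ m, e = Ev.nb m)

/-- Nominal network transitions. -/
def netTransNom (q : NSt) (e : Ev) (q' : NSt) : Prop :=
  (∃ m, q = .init ∧ e = .an m ∧ q' = .qa m) ∨
  (∃ m, q = .qa m ∧ e = .nb m ∧ q' = .init) ∨
  (∃ m, q = .init ∧ e = .bn m ∧ q' = .qb m) ∨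
  (∃ m, q = .qb m ∧ e = .na m ∧ q' = .init)

/-- The attacker's controllable events: the outgoing packets of the network. -/
def ATTK : Set Ev := {e | ∃ m, e = Ev.na m ∨ e = Ev.nb m}

/-- Attacked network transitions: from any non-initial state the attacker may emit any
event of `ATTK`. -/
def netTransAtk (q : NSt) (e : Ev) (q' : NSt) : Prop :=
  (∃ m, q = .init ∧ e = .an m ∧ q' = .qa m) ∨
  (∃ m, q = .init ∧ e = .bn m ∧ q' = .qb m) ∨
  ((∃ m, q = .qa m ∨ q = .qb m) ∧ e ∈ ATTK ∧ q' = .init)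

/-- Synchronization of one component: if the event is in the component's alphabet, the
component must execute a transition on it; otherwise the component does not move. -/
def sync {Q : Type*} (alph : Ev → Prop) (trans : Q → Ev → Q → Prop)
    (q : Q) (e : Ev) (q' : Q) : Prop :=
  (alph e ∧ trans q e q') ∨ (¬ alph e ∧ q' = q)

/-- Global states of the channel-free TCP system. -/
structure GSt where
  pa : PSt
  pb : PSt
  net : NSt
  deriving DecidableEq

/-- Global step of the synchronous composition, parametrized by the network. -/
def gstep (net : NSt → Ev → NSt → Prop) (q : GSt) (e : Ev) (q' : GSt) : Prop :=
  sync peerAAlph peerAStep q.pa e q'.pa ∧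
  sync peerBAlph peerBStep q.pb e q'.pb ∧
  sync netAlph net q.net e q'.net

/-- Runs of the composition. -/
inductive Reach (step : GSt → Ev → GSt → Prop) (q0 : GSt) : List Ev → GSt → Prop
  | nil : Reach step q0 [] q0
  | snoc {s : List Ev} {q : GSt} {e : Ev} {q' : GSt} :
      Reach step q0 s q → step q e q' → Reach step q0 (s ++ [e]) q'

/-- Initial global state. -/
def init : GSt := ⟨.closed, .closed, .init⟩

/-- Generated language. -/
def Lang (step : GSt → Ev → GSt → Prop) : Set (List Ev) :=
  {s | ∃ q, Reach step init s q}

/-- The attacked channel-free TCP system `G_a`. -/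
def atkStep : GSt → Ev → GSt → Prop := gstep netTransAtk

/-- The string `listen_A · SYN_BN · SYN_NA · SYN_ACK_AN · ACK_NA · FIN_AN · ACK_NA`. -/
def atkString : List Ev :=
  [.listenA, .bn .syn, .na .syn, .an .synack, .na .ack, .an .fin, .na .ack]

theorem reach_nil_iff {step : GSt → Ev → GSt → Prop} {q₀ q : GSt} :
    Reach step q₀ [] q ↔ q = q₀ := by
  constructor
  · intro h
    generalize hs : ([] : List Ev) = s at h
    cases h with
    | nil => rfl
    | snoc _ _ => simp at hs
  · rintro rfl
    exact .nil

theorem reach_append_singleton_iff {step : GSt → Ev → GSt → Prop} {q₀ q' : GSt}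
    {s : List Ev} {e : Ev} :
    Reach step q₀ (s ++ [e]) q' ↔ ∃ q, Reach step q₀ s q ∧ step q e q' := by
  constructor
  · intro h
    generalize hs : s ++ [e] = t at h
    cases h with
    | nil => simp at hs
    | snoc h₁ h₂ =>
      obtain ⟨rfl, he⟩ := List.append_inj' hs rfl
      obtain rfl := List.singleton_inj.mp he
      exact ⟨_, h₁, h₂⟩
  · rintro ⟨q, h₁, h₂⟩
    exact h₁.snoc h₂

theorem reach_atkString_iff {q : GSt} :
    Reach atkStep init atkString q ↔ q = ⟨.finwait2, .synsent, .init⟩ := by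
  have split : atkString = ((((((([] ++ [.listenA]) ++ [.bn .syn]) ++ [.na .syn]) ++
      [.an .synack]) ++ [.na .ack]) ++ [.an .fin]) ++ [.na .ack]) := rfl
  have step₁ (q : GSt) : atkStep init .listenA q ↔ q = ⟨.listen, .closed, .init⟩ := by
    cases q
    simp [atkStep, gstep, sync, peerAAlph, peerBAlph, peerAlph, netAlph, peerAStep,
      peerBStep, peerTrans, netTransAtk, ATTK, init]
  have step₂ (q : GSt) : atkStep ⟨.listen, .closed, .init⟩ (.bn .syn) q ↔
      q = ⟨.listen, .synsent, .qb .syn⟩ := by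
    cases q
    simp [atkStep, gstep, sync, peerAAlph, peerBAlph, peerAlph, netAlph, peerAStep,
      peerBStep, peerTrans, netTransAtk, ATTK]
  have step₃ (q : GSt) : atkStep ⟨.listen, .synsent, .qb .syn⟩ (.na .syn) q ↔
      q = ⟨.i2, .synsent, .init⟩ := by
    cases q
    simp [atkStep, gstep, sync, peerAAlph, peerBAlph, peerAlph, netAlph, peerAStep,
      peerBStep, peerTrans, netTransAtk, ATTK]
  have step₄ (q : GSt) : atkStep ⟨.i2, .synsent, .init⟩ (.an .synack) q ↔
      q = ⟨.synreceived, .synsent, .qa .synack⟩ := by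
    cases q
    simp [atkStep, gstep, sync, peerAAlph, peerBAlph, peerAlph, netAlph, peerAStep,
      peerBStep, peerTrans, netTransAtk, ATTK]
  have step₅ (q : GSt) : atkStep ⟨.synreceived, .synsent, .qa .synack⟩ (.na .ack) q ↔
      q = ⟨.established, .synsent, .init⟩ := by
    cases q
    simp [atkStep, gstep, sync, peerAAlph, peerBAlph, peerAlph, netAlph, peerAStep,
      peerBStep, peerTrans, netTransAtk, ATTK]
  have step₆ (q : GSt) : atkStep ⟨.established, .synsent, .init⟩ (.an .fin) q ↔
      q = ⟨.finwait1, .synsent, .qa .fin⟩ := by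
    cases q
    simp [atkStep, gstep, sync, peerAAlph, peerBAlph, peerAlph, netAlph, peerAStep,
      peerBStep, peerTrans, netTransAtk, ATTK]
  have step₇ (q : GSt) : atkStep ⟨.finwait1, .synsent, .qa .fin⟩ (.na .ack) q ↔
      q = ⟨.finwait2, .synsent, .init⟩ := by
    cases q
    simp [atkStep, gstep, sync, peerAAlph, peerBAlph, peerAlph, netAlph, peerAStep,
      peerBStep, peerTrans, netTransAtk, ATTK]
  simp only [split, reach_append_singleton_iff, reach_nil_iff, exists_eq_left,
    step₁, step₂, step₃, step₄, step₅, step₆, step₇]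

theorem not_atkStep_finwait2_synsent_init (e : Ev) (q : GSt) :
    ¬ atkStep ⟨.finwait2, .synsent, .init⟩ e q := by
  cases e <;>
    simp [atkStep, gstep, sync, peerAAlph, peerBAlph, peerAlph, netAlph, peerAStep,
      peerBStep, peerTrans, netTransAtk]

/-- the string belongs to `L(G_a)`; it leads (only) to the global
state with Peer A at `FIN wait 2`, Peer B at `SYN sent` and the network at `init`, and
that state is a deadlock: no event can extend the string within `L(G_a)`.  In particular
the attacked system can reach a deadlock in which neither peer is at `closed`, violating
the liveness property of Threat Model 3. -/
theorem stmt18 :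
    atkString ∈ Lang atkStep ∧
    (∀ q : GSt, Reach atkStep init atkString q →
      q = ⟨PSt.finwait2, PSt.synsent, NSt.init⟩) ∧
    (∀ e : Ev, atkString ++ [e] ∉ Lang atkStep) := by
  refine ⟨⟨_, reach_atkString_iff.mpr rfl⟩, fun q => reach_atkString_iff.mp, ?_⟩
  rintro e ⟨q', h⟩
  obtain ⟨q, hq, hstep⟩ := reach_append_singleton_iff.mp h
  rw [reach_atkString_iff.mp hq] at hstep
  exact not_atkStep_finwait2_synsent_init e q' hstep
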